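/- Let χ₊, χ₋ : 𝕋 → ℝ be smooth functions forming a partition of unity in the sense χ₊(x)² + χ₋(x)² = 1 for all x. Then there exists a constant C > 0 such that for every u ∈ H¹(𝕋;ℂ), writing u_± = χ_± u, one has both ‖∂_x u‖² ≥ (2/3)(‖∂_x u₊‖² + ‖∂_x u₋‖²) − C‖u‖² and ‖∂_x u₊‖² + ‖∂_x u₋‖² ≥ (3/4)‖∂_x u‖² − C‖u‖². -/

import Mathlib

/- L² squared norm on the torus 𝕋 = ℝ/2πℤ, modeled via `2π`-periodic
   functions `ℝ → ℂ`. -/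
noncomputable def tnormSq (f : ℝ → ℂ) : ℝ :=
  ∫ x in (0:ℝ)..(2 * Real.pi), ‖f x‖ ^ 2

/-- for a smooth partition of unity `χ₊² + χ₋² = 1` on the torus,
there is a constant `C > 0` such that for every `u ∈ H¹(𝕋;ℂ)`, with `u_± = χ_± u`:
`‖∂ₓu‖² ≥ (2/3)(‖∂ₓu₊‖² + ‖∂ₓu₋‖²) - C‖u‖²` and
`‖∂ₓu₊‖² + ‖∂ₓu₋‖² ≥ (3/4)‖∂ₓu‖² - C‖u‖²`. -/
theorem stmt10 (χp χm : ℝ → ℝ)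
    (hχp : ContDiff ℝ (⊤ : ℕ∞) χp) (hχm : ContDiff ℝ (⊤ : ℕ∞) χm)
    (hχp_per : Function.Periodic χp (2 * Real.pi))
    (hχm_per : Function.Periodic χm (2 * Real.pi))
    (hpart : ∀ x : ℝ, χp x ^ 2 + χm x ^ 2 = 1) :
    ∃ C : ℝ, 0 < C ∧
      ∀ u : ℝ → ℂ, ContDiff ℝ 1 u → Function.Periodic u (2 * Real.pi) →
        tnormSq (deriv u) ≥
          (2 / 3) * (tnormSq (deriv (fun x => (χp x : ℂ) * u x))
            + tnormSq (deriv (fun x => (χm x : ℂ) * u x))) - C * tnormSq u ∧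
        tnormSq (deriv (fun x => (χp x : ℂ) * u x))
            + tnormSq (deriv (fun x => (χm x : ℂ) * u x)) ≥
          (3 / 4) * tnormSq (deriv u) - C * tnormSq u := by
  have hdp : Differentiable ℝ χp := hχp.differentiable (by simp)
  have hdm : Differentiable ℝ χm := hχm.differentiable (by simp)
  have hcp : Continuous (deriv χp) := hχp.continuous_deriv (by simp)
  have hcm : Continuous (deriv χm) := hχm.continuous_deriv (by simp)
  have horth : ∀ x, χp x * deriv χp x + χm x * deriv χm x = 0 := by
    intro x
    have h1 := ((hdp x).hasDerivAt.pow 2).add ((hdm x).hasDerivAt.pow 2)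
    have h2 : (χp ^ 2 + χm ^ 2) = fun _ => (1 : ℝ) := by
      funext y
      simpa using hpart y
    rw [h2] at h1
    have h3 := h1.unique (hasDerivAt_const x (1 : ℝ))
    norm_num at h3
    linarith
  have hVc : Continuous (fun x => deriv χp x ^ 2 + deriv χm x ^ 2) := by fun_prop
  obtain ⟨M, hM⟩ := (isCompact_Icc (a := (0 : ℝ)) (b := 2 * Real.pi)).bddAbove_image
    hVc.continuousOn
  have hpi : (0 : ℝ) ≤ 2 * Real.pi := by positivity
  refine ⟨max M 1, by positivity, ?_⟩
  intro u hu _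
  have hdu : Differentiable ℝ u := hu.differentiable (by simp)
  have hcu : Continuous u := hu.continuous
  have hcdu : Continuous (deriv u) := hu.continuous_deriv (by simp)
  have hder : ∀ χ : ℝ → ℝ, Differentiable ℝ χ →
      deriv (fun x => (χ x : ℂ) * u x) =
        fun x => ((deriv χ x : ℝ) : ℂ) * u x + (χ x : ℂ) * deriv u x := by
    intro χ hχ
    funext x
    exact ((hχ x).hasDerivAt.ofReal_comp.mul (hdu x).hasDerivAt).deriv
  have hkey : tnormSq (deriv (fun x => (χp x : ℂ) * u x))
      + tnormSq (deriv (fun x => (χm x : ℂ) * u x)) = tnormSq (deriv u) +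
        ∫ x in (0:ℝ)..(2 * Real.pi), (deriv χp x ^ 2 + deriv χm x ^ 2) * ‖u x‖ ^ 2 := by
    have hcχp := hdp.continuous
    have hcχm := hdm.continuous
    rw [hder χp hdp, hder χm hdm]
    unfold tnormSq
    rw [← intervalIntegral.integral_add, ← intervalIntegral.integral_add]
    · congr 1
      funext x
      have h1 := horth x
      have h2 := hpart x
      simp only [Complex.sq_norm, Complex.normSq_apply, Complex.add_re, Complex.add_im,
        Complex.mul_re, Complex.mul_im, Complex.ofReal_re, Complex.ofReal_im]
      linear_combination (2 * ((u x).re * (deriv u x).re + (u x).im * (deriv u x).im)) * h1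
        + ((deriv u x).re ^ 2 + (deriv u x).im ^ 2) * h2
    all_goals exact Continuous.intervalIntegrable (by fun_prop) _ _
  have hV0 : 0 ≤ ∫ x in (0:ℝ)..(2 * Real.pi),
      (deriv χp x ^ 2 + deriv χm x ^ 2) * ‖u x‖ ^ 2 :=
    intervalIntegral.integral_nonneg hpi (fun x _ => by positivity)
  have hV1 : (∫ x in (0:ℝ)..(2 * Real.pi),
      (deriv χp x ^ 2 + deriv χm x ^ 2) * ‖u x‖ ^ 2) ≤ max M 1 * tnormSq u := by
    unfold tnormSq
    rw [← intervalIntegral.integral_const_mul]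
    refine intervalIntegral.integral_mono_on hpi
      (Continuous.intervalIntegrable (by fun_prop) _ _)
      (Continuous.intervalIntegrable (by fun_prop) _ _) ?_
    intro x hx
    have : deriv χp x ^ 2 + deriv χm x ^ 2 ≤ max M 1 :=
      (hM ⟨x, hx, rfl⟩).trans (le_max_left _ _)
    gcongr
  have hu0 : 0 ≤ tnormSq (deriv u) :=
    intervalIntegral.integral_nonneg hpi (fun x _ => by positivity)
  rw [hkey]
  constructor <;> linarith
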